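/- arXiv:1803.09899 — 4 statements merged into one kernel-verified Lean document; each statement's English description precedes it below -/
import Mathlib

section
/- Let α > 0, β > 0 and κ ≥ 1 be real numbers. For every ξ ∈ [0, 2π], every eigenvalue of the Hermitian positive semidefinite matrix G(ξ)*G(ξ) (where G(ξ)* is the conjugate transpose of G(ξ)) is at most 1 if and only if β ≤ min{2α, 1/(2κα)}. -/
open Real Matrix

/-- The amplification matrix `G(ξ)` with `ω₁ = 4αβ sin²(ξ/2)` and `ω₂ = β sin ξ`. -/
noncomputable def ampG (α β κ ξ : ℝ) : Matrix (Fin 2) (Fin 2) ℂ :=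
  !![((1 - 4*α*β*(Real.sin (ξ/2))^2 : ℝ) : ℂ), -Complex.I * ((β * Real.sin ξ : ℝ) : ℂ);
     -Complex.I * ((β * Real.sin ξ : ℝ) : ℂ), ((1 - κ*(4*α*β*(Real.sin (ξ/2))^2) : ℝ) : ℂ)]

/-- The characteristic equation of a Hermitian `2 × 2` matrix with imaginary off-diagonal part. -/
lemma mem_spectrum_hermitian_two_iff (A B e : ℝ) (μ : ℂ) :
    μ ∈ spectrum ℂ (!![(A : ℂ), Complex.I * e; -Complex.I * e, (B : ℂ)]) ↔
      (μ - A) * (μ - B) = (e : ℂ) ^ 2 := by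
  have hdet : (algebraMap ℂ (Matrix (Fin 2) (Fin 2) ℂ) μ -
      !![(A : ℂ), Complex.I * e; -Complex.I * e, (B : ℂ)]).det =
      (μ - A) * (μ - B) - (e : ℂ) ^ 2 := by
    rw [Matrix.det_fin_two]
    simp [Matrix.algebraMap_matrix_apply]
    linear_combination (e : ℂ) ^ 2 * Complex.I_sq
  rw [spectrum.mem_iff, Matrix.isUnit_iff_isUnit_det, hdet, isUnit_iff_ne_zero, not_not,
    sub_eq_zero]

lemma spectrum_hermitian_two_re_le_one {A B e : ℝ} (hA : A ≤ 1) (hB : B ≤ 1)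
    (he : e ^ 2 ≤ (1 - A) * (1 - B)) {μ : ℂ}
    (hμ : μ ∈ spectrum ℂ (!![(A : ℂ), Complex.I * e; -Complex.I * e, (B : ℂ)])) :
    μ.re ≤ 1 := by
  rw [mem_spectrum_hermitian_two_iff] at hμ
  have hre := congrArg Complex.re hμ
  have him := congrArg Complex.im hμ
  simp [pow_two] at hre him
  by_contra! h
  have hsum : μ.re - A + (μ.re - B) ≠ 0 := by linarith
  have hy : μ.im = 0 := by
    have : μ.im * (μ.re - A + (μ.re - B)) = 0 := by linarith
    exact (mul_eq_zero.mp this).resolve_right hsum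
  rw [hy] at hre
  nlinarith [mul_nonneg (sub_nonneg.2 h.le) (sub_nonneg.2 hA),
    mul_nonneg (sub_nonneg.2 h.le) (sub_nonneg.2 hB), mul_pos (sub_pos.2 h) (sub_pos.2 h)]

lemma diag_le_one_of_spectrum_re_le_one {A B e : ℝ}
    (h : ∀ μ ∈ spectrum ℂ (!![(A : ℂ), Complex.I * e; -Complex.I * e, (B : ℂ)]), μ.re ≤ 1) :
    A ≤ 1 ∧ B ≤ 1 := by
  set r := √(((A - B) / 2) ^ 2 + e ^ 2)
  have hr : r ^ 2 = ((A - B) / 2) ^ 2 + e ^ 2 := Real.sq_sqrt (by positivity)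
  have hdom : |(A - B) / 2| ≤ r := Real.abs_le_sqrt (by nlinarith [sq_nonneg e])
  have hx := h (((A + B) / 2 + r : ℝ) : ℂ) <| by
    rw [mem_spectrum_hermitian_two_iff]
    norm_cast
    linear_combination hr
  rw [Complex.ofReal_re] at hx
  obtain ⟨h₁, h₂⟩ := abs_le.mp hdom
  constructor <;> linarith

lemma ampG_conjTranspose_mul_self (α β κ ξ : ℝ) :
    (ampG α β κ ξ)ᴴ * ampG α β κ ξ =
      !![(((1 - 4 * α * β * sin (ξ / 2) ^ 2) ^ 2 + (β * sin ξ) ^ 2 : ℝ) : ℂ),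
          Complex.I * ((β * sin ξ * ((1 - κ) * (4 * α * β * sin (ξ / 2) ^ 2)) : ℝ) : ℂ);
        -Complex.I * ((β * sin ξ * ((1 - κ) * (4 * α * β * sin (ξ / 2) ^ 2)) : ℝ) : ℂ),
          (((1 - κ * (4 * α * β * sin (ξ / 2) ^ 2)) ^ 2 + (β * sin ξ) ^ 2 : ℝ) : ℂ)] := by
  generalize hw : 4 * α * β * sin (ξ / 2) ^ 2 = w
  generalize hc : β * sin ξ = c
  unfold ampG
  rw [hw, hc]
  ext i j
  fin_cases i <;> fin_cases j <;>
    simp [Matrix.mul_apply, Fin.sum_univ_two, -Complex.ofReal_sin] <;> ring_nf <;>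
    simp [Complex.I_sq]

lemma sin_sq_eq_half_angle (ξ : ℝ) :
    sin ξ ^ 2 = 4 * sin (ξ / 2) ^ 2 * (1 - sin (ξ / 2) ^ 2) := by
  have h : sin ξ = 2 * sin (ξ / 2) * cos (ξ / 2) := by
    rw [← Real.sin_two_mul]; congr 1; ring
  rw [h, ← Real.cos_sq']
  ring

lemma exists_sin_half_sq_eq {s : ℝ} (h₀ : 0 ≤ s) (h₁ : s ≤ 1) :
    ∃ ξ ∈ Set.Icc (0 : ℝ) (2 * π), sin (ξ / 2) ^ 2 = s := by
  have hs : √s ≤ 1 := Real.sqrt_le_one.mpr h₁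
  refine ⟨2 * arcsin √s, ⟨?_, ?_⟩, ?_⟩
  · linarith [Real.arcsin_nonneg.mpr (Real.sqrt_nonneg s)]
  · linarith [Real.arcsin_le_pi_div_two √s, Real.pi_pos]
  · rw [mul_div_cancel_left₀ _ two_ne_zero,
      Real.sin_arcsin (by linarith [Real.sqrt_nonneg s]) hs, Real.sq_sqrt h₀]

theorem stmt1 (α β κ : ℝ) (hα : 0 < α) (hβ : 0 < β) (hκ : 1 ≤ κ) :
    (∀ ξ ∈ Set.Icc (0:ℝ) (2*π),
        ∀ μ ∈ spectrum ℂ ((ampG α β κ ξ)ᴴ * ampG α β κ ξ), μ.re ≤ 1) ↔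
      β ≤ min (2*α) (1/(2*κ*α)) := by
  have hκ₀ : 0 < κ := by linarith
  rw [le_min_iff, le_div_iff₀ (by positivity)]
  constructor
  · intro h
    have key : ∀ s : ℝ, 0 ≤ s → s ≤ 1 →
        (1 - 4 * α * β * s) ^ 2 + β ^ 2 * (4 * s * (1 - s)) ≤ 1 ∧
        (1 - κ * (4 * α * β * s)) ^ 2 + β ^ 2 * (4 * s * (1 - s)) ≤ 1 := by
      intro s h₀ h₁
      obtain ⟨ξ, hξ, hs⟩ := exists_sin_half_sq_eq h₀ h₁
      have hG := h ξ hξ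
      rw [ampG_conjTranspose_mul_self] at hG
      simpa only [mul_pow, sin_sq_eq_half_angle, hs] using diag_le_one_of_spectrum_re_le_one hG
    constructor
    · by_contra! hlt
      set s := (β - 2 * α) / (2 * β) with hs
      have hsβ : s * (2 * β) = β - 2 * α := div_mul_cancel₀ _ (by positivity)
      have hs₀ : 0 < s := div_pos (by linarith) (by positivity)
      have hs₁ : s ≤ 1 := by rw [hs, div_le_one (by positivity)]; linarith
      have hk := (key s hs₀.le hs₁).1
      have hfac : 0 ≤ 4 * β * s * ((2 * α - β) + s * β * (1 - 4 * α ^ 2)) := by linarith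
      have hpos := nonneg_of_mul_nonneg_right hfac (by positivity)
      have : 0 < s * β * (4 * α ^ 2) := by positivity
      linarith
    · have hk := (key 1 zero_le_one le_rfl).2
      have hfac : 0 ≤ 8 * κ * α * β * (1 - β * (2 * κ * α)) := by linarith
      linarith [nonneg_of_mul_nonneg_right hfac (by positivity)]
  · rintro ⟨h₁, h₂⟩ ξ - μ hμ
    rw [ampG_conjTranspose_mul_self] at hμ
    set s := sin (ξ / 2) ^ 2
    have hs₀ : 0 ≤ s := sq_nonneg _
    have hs₁ : s ≤ 1 := Real.sin_sq_le_one _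
    have hc : (β * sin ξ) ^ 2 = β ^ 2 * (4 * s * (1 - s)) := by
      rw [mul_pow, sin_sq_eq_half_angle]
    have hf : 0 ≤ α * (2 - κ * (4 * α * β * s)) - β * (1 - s) := by
      have := mul_nonneg (sub_nonneg.2 h₁) (sub_nonneg.2 hs₁)
      have := mul_nonneg (mul_nonneg hα.le hs₀) (sub_nonneg.2 h₂)
      linarith
    have hg : 0 ≤ α * (2 * κ - κ * (4 * α * β * s)) - β * (1 - s) := by
      have := mul_nonneg hα.le (sub_nonneg.2 hκ)
      linarith
    have ha : 0 ≤ α * (2 - 4 * α * β * s) - β * (1 - s) := by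
      have : 0 ≤ α * (4 * α * β * s) * (κ - 1) :=
        mul_nonneg (by positivity) (sub_nonneg.2 hκ)
      linarith
    have hb : 0 ≤ κ * α * (2 - κ * (4 * α * β * s)) - β * (1 - s) := by
      have hnn : 0 ≤ α * (2 - κ * (4 * α * β * s)) := by
        have := mul_nonneg hβ.le (sub_nonneg.2 hs₁)
        linarith
      have := mul_nonneg (sub_nonneg.2 hκ) hnn
      linarith
    have hβs : 0 ≤ 4 * β * s := by positivity
    refine spectrum_hermitian_two_re_le_one ?_ ?_ ?_ hμ
    · linarith [mul_nonneg hβs ha]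
    · linarith [mul_nonneg hβs hb]
    · rw [mul_pow (β * sin ξ), hc]
      linarith [mul_nonneg (mul_nonneg hβs hβs) (mul_nonneg hf hg)]
end

section
/- Let α > 0, β > 0 and κ ≥ 1 be real numbers satisfying β ≤ min{(κ+1)α, (κ+1)/(4κα)}, and define r(θ) = β²(4κα² − 1)θ² − β(2(κ+1)α − β)θ + 1. Then r(θ) ≥ 0 for all θ ∈ [0, 1] if and only if r(1) = 4κα²β² − 2(κ+1)αβ + 1 ≥ 0. -/
theorem stmt9 (α β κ : ℝ) (hα : 0 < α) (hβ : 0 < β) (hκ : 1 ≤ κ)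
    (hcond : β ≤ min ((κ+1)*α) ((κ+1)/(4*κ*α))) :
    (∀ θ ∈ Set.Icc (0:ℝ) 1,
        β^2*(4*κ*α^2 - 1)*θ^2 - β*(2*(κ+1)*α - β)*θ + 1 ≥ 0) ↔
      4*κ*α^2*β^2 - 2*(κ+1)*α*β + 1 ≥ 0 := by
  constructor
  · intro h
    linarith [h 1 ⟨zero_le_one, le_rfl⟩]
  · rintro h θ ⟨h0, h1⟩
    have hκα : 0 < 4 * κ * α := by positivity
    have hβκ : β * (4 * κ * α) ≤ κ + 1 :=
      (le_div_iff₀ hκα).1 (hcond.trans (min_le_right _ _))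
    obtain ⟨A, hA⟩ : ∃ A, A = β^2*(4*κ*α^2 - 1) := ⟨_, rfl⟩
    obtain ⟨B, hB⟩ : ∃ B, B = β*(2*(κ+1)*α - β) := ⟨_, rfl⟩
    have hAB : 2 * A ≤ B := by
      have := mul_le_mul_of_nonneg_left hβκ (mul_pos hα hβ).le
      nlinarith [sq_nonneg β]
    have hr : 0 ≤ A - B + 1 := by
      rw [hA, hB]
      linarith
    rw [← hA, ← hB]
    rcases le_or_gt A 0 with hA0 | hA0
    · -- concave case: compare with the chord through the endpoints
      nlinarith [mul_nonneg (mul_nonneg (neg_nonneg.2 hA0) h0) (sub_nonneg.2 h1),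
        mul_nonneg h0 hr]
    · -- convex case: the parabola is decreasing on the unit interval
      have hslope : 0 ≤ B - A * (1 + θ) := by nlinarith
      nlinarith [mul_nonneg (sub_nonneg.2 h1) hslope]
end

section
/- Let α > 0, β > 0 and κ ≥ 0 be real numbers. Then 8α²β²(κ² + 1)θ² + 4β²θ(1 − θ) − 4αβ(κ + 1)θ ≤ 0 holds for all θ ∈ [0, 1] if and only if β ≤ min{(κ+1)α, (κ+1)/(2(κ²+1)α)}. -/
theorem trace_condition_factor (α β κ θ : ℝ) :
    8*α^2*β^2*(κ^2 + 1)*θ^2 + 4*β^2*θ*(1 - θ) - 4*α*β*(κ + 1)*θ =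
      4*β*θ * (2*α^2*β*(κ^2 + 1)*θ + β*(1 - θ) - (κ + 1)*α) := by
  ring

theorem stmt12 (α β κ : ℝ) (hα : 0 < α) (hβ : 0 < β) (hκ : 0 ≤ κ) :
    (∀ θ ∈ Set.Icc (0:ℝ) 1,
        8*α^2*β^2*(κ^2 + 1)*θ^2 + 4*β^2*θ*(1 - θ) - 4*α*β*(κ + 1)*θ ≤ 0) ↔
      β ≤ min ((κ+1)*α) ((κ+1)/(2*(κ^2+1)*α)) := by
  simp only [trace_condition_factor]
  rw [le_min_iff, le_div_iff₀ (by positivity)]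
  constructor
  · intro h
    refine ⟨?_, ?_⟩
    · by_contra! hlt
      -- At this interior point the last two terms of the linear factor cancel.
      set θ := 1 - (κ + 1)*α/β with hθ
      have hθ_pos : 0 < θ := sub_pos.2 ((div_lt_one hβ).2 hlt)
      have hθ_le : θ ≤ 1 := sub_le_self _ (by positivity)
      have hcancel : β*(1 - θ) = (κ + 1)*α := by rw [hθ]; field_simp; ring
      have hle := h θ ⟨hθ_pos.le, hθ_le⟩
      rw [add_sub_assoc, hcancel, sub_self, add_zero] at hle
      exact hle.not_gt (by positivity)
    · have hle := h 1 ⟨zero_le_one, le_rfl⟩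
      have hfactor := nonpos_of_mul_nonpos_right hle (by positivity)
      refine le_of_mul_le_mul_right ?_ hα
      linarith
  · rintro ⟨h₀, h₁⟩ θ ⟨hθ₀, hθ₁⟩
    refine mul_nonpos_of_nonneg_of_nonpos (by positivity) ?_
    have hleft := mul_le_mul_of_nonneg_left h₀ (sub_nonneg.2 hθ₁)
    have hright := mul_le_mul_of_nonneg_left h₁ (mul_nonneg hα.le hθ₀)
    linarith
end

section
/- Let κ ≥ 1, ω₁ and ω₂ be real numbers, let G be the 2×2 complex matrix G = [[1 − ω₁, −i ω₂], [−i ω₂, 1 − κω₁]], and set q₂(1) = 1 − tr(G*G) + (det G)². Then q₂(1) = (b − (κ−1)ω₁)(b + (κ−1)ω₁) where b = κω₁² + ω₂² − (κ+1)ω₁; consequently q₂(1) ≥ 0 if and only if κω₁² + ω₂² − 2ω₁ ≤ 0 or κω₁² + ω₂² − 2κω₁ ≥ 0. -/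
open Matrix

theorem stmt13 (κ ω₁ ω₂ : ℝ) (hκ : 1 ≤ κ)
    (G : Matrix (Fin 2) (Fin 2) ℂ)
    (hG : G = !![((1 - ω₁ : ℝ) : ℂ), -Complex.I * (ω₂ : ℂ);
                 -Complex.I * (ω₂ : ℂ), ((1 - κ*ω₁ : ℝ) : ℂ)]) :
    ((1 : ℂ) - (Gᴴ * G).trace + G.det^2 =
        (((κ*ω₁^2 + ω₂^2 - (κ+1)*ω₁ - (κ-1)*ω₁) *
          (κ*ω₁^2 + ω₂^2 - (κ+1)*ω₁ + (κ-1)*ω₁) : ℝ) : ℂ)) ∧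
      (0 ≤ ((1 : ℂ) - (Gᴴ * G).trace + G.det^2).re ↔
        (κ*ω₁^2 + ω₂^2 - 2*ω₁ ≤ 0 ∨ κ*ω₁^2 + ω₂^2 - 2*κ*ω₁ ≥ 0)) := by
  have factored : (1 : ℂ) - (Gᴴ * G).trace + G.det^2 =
      (((κ*ω₁^2 + ω₂^2 - (κ+1)*ω₁ - (κ-1)*ω₁) *
        (κ*ω₁^2 + ω₂^2 - (κ+1)*ω₁ + (κ-1)*ω₁) : ℝ) : ℂ) := by
    subst hG
    simp only [trace_fin_two, det_fin_two, mul_apply, Fin.sum_univ_two, conjTranspose_apply,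
      of_apply, cons_val', cons_val_zero, cons_val_one, cons_val_fin_one, map_mul, map_neg,
      Complex.star_def, Complex.conj_I, Complex.conj_ofReal]
    push_cast
    ring_nf
    simp only [Complex.I_sq, Complex.I_pow_four]
    ring
  refine ⟨factored, ?_⟩
  rw [factored, Complex.ofReal_re]
  have hA : κ*ω₁^2 + ω₂^2 - (κ+1)*ω₁ - (κ-1)*ω₁ = κ*ω₁^2 + ω₂^2 - 2*κ*ω₁ := by ring
  have hB : κ*ω₁^2 + ω₂^2 - (κ+1)*ω₁ + (κ-1)*ω₁ = κ*ω₁^2 + ω₂^2 - 2*ω₁ := by ring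
  rw [hA, hB]
  have hsq : 0 ≤ κ*ω₁^2 + ω₂^2 := by positivity
  constructor
  · intro h
    by_contra! hneg
    exact absurd h (not_le.mpr (mul_neg_of_neg_of_pos hneg.2 hneg.1))
  · rcases le_total 0 ω₁ with hω | hω
    · have hle : ω₁ ≤ κ*ω₁ := le_mul_of_one_le_left hω hκ
      rintro (h | h)
      · exact mul_nonneg_of_nonpos_of_nonpos (by linarith) h
      · exact mul_nonneg h (by linarith)
    · have hle : κ*ω₁ ≤ 0 := mul_nonpos_of_nonneg_of_nonpos (by linarith) hω
      intro _
      exact mul_nonneg (by linarith) (by linarith)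
end
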